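/- Let n ≥ 1 and let N be a finite set with n elements. Suppose φ assigns to every set function v : Finset N → ℝ a vector (φ_i(v))_{i ∈ N} ∈ ℝ^N and satisfies: (efficiency) Σ_{i∈N} φ_i(v) = v(N) − v(∅) for all v; (symmetry) φ_i(v) = φ_j(v) whenever v(S ∪ {i}) = v(S ∪ {j}) for all S ⊆ N \ {i, j}; (null player) φ_i(v) = 0 whenever v(S ∪ {i}) = v(S) for all S ⊆ N \ {i}; and (additivity) φ_i(v + w) = φ_i(v) + φ_i(w) for all v, w and all i. Then φ_i(v) = DS_i(v) for every v and every i ∈ N, where DS_i(v) := Σ over all subsets S ⊆ N \ {i} of (|S|! · (n − 1 − |S|)! / n!) · [v(S ∪ {i}) − v(S)]. -/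

import Mathlib

open Finset

/-- An additive, symmetric, null-player operator with total `0` vanishes. -/
lemma shap_zero {N : Type*} [Fintype N] [DecidableEq N]
    (ψ : (Finset N → ℝ) → N → ℝ)
    (heff : ∀ v : Finset N → ℝ, ∑ i : N, ψ v i = 0)
    (hsym : ∀ (v : Finset N → ℝ) (i j : N),
      (∀ S : Finset N, i ∉ S → j ∉ S → v (insert i S) = v (insert j S)) →
      ψ v i = ψ v j)
    (hnull : ∀ (v : Finset N → ℝ) (i : N),
      (∀ S : Finset N, i ∉ S → v (insert i S) = v S) → ψ v i = 0)
    (hadd : ∀ (v w : Finset N → ℝ) (i : N), ψ (v + w) i = ψ v i + ψ w i)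
    (v : Finset N → ℝ) (i : N) : ψ v i = 0 := by
  have hu : ∀ (T : Finset N) (c : ℝ) (i : N),
      ψ (fun S => if T ⊆ S then c else 0) i = 0 := by
    intro T c
    have h1 : ∀ i, i ∉ T → ψ (fun S => if T ⊆ S then c else 0) i = 0 := by
      intro i hi
      apply hnull
      intro S _
      simp only [Finset.subset_insert_iff_of_notMem hi]
    intro i
    by_cases hi : i ∈ T
    · have h2 : ∀ j ∈ T, ψ (fun S => if T ⊆ S then c else 0) j
          = ψ (fun S => if T ⊆ S then c else 0) i := by
        intro j hj
        by_cases hij : j = i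
        · rw [hij]
        apply hsym
        intro S hjS hiS
        have a : ¬ T ⊆ insert j S := fun h => by
          have := h hi
          simp [hiS, Ne.symm hij] at this
        have b : ¬ T ⊆ insert i S := fun h => by
          have := h hj
          simp [hjS, hij] at this
        simp only [a, b]
      have h3 := heff (fun S => if T ⊆ S then c else 0)
      rw [← Finset.sum_subset (Finset.subset_univ T) (fun x _ hx => h1 x hx),
        Finset.sum_congr rfl h2, Finset.sum_const, nsmul_eq_mul] at h3
      have : (T.card : ℝ) ≠ 0 := by
        exact_mod_cast Finset.card_ne_zero_of_mem hi
      exact (mul_eq_zero.mp h3).resolve_left this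
    · exact h1 i hi
  have key : ∀ m : ℕ, ∀ v : Finset N → ℝ,
      (∀ S : Finset N, S.card + m ≤ Fintype.card N → v S = 0) → ψ v i = 0 := by
    intro m
    induction m with
    | zero =>
      intro v hv
      apply hnull
      intro S _
      rw [hv _ (Finset.card_le_univ _), hv _ (Finset.card_le_univ _)]
    | succ m ih =>
      intro v hv
      let F : (Finset N → ℝ) →+ ℝ := AddMonoidHom.mk' (fun v => ψ v i) (fun a b => hadd a b i)
      let w : Finset N → ℝ := ∑ T ∈ Finset.univ.filter (fun T : Finset N =>
        T.card + m = Fintype.card N), (fun S => if T ⊆ S then v T else 0)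
      have hw : ψ w i = 0 := by
        change F w = 0
        rw [map_sum]
        exact Finset.sum_eq_zero (fun T _ => hu T _ i)
      have hvw : ψ (v - w) i = 0 := by
        apply ih
        intro S hS
        have : w S = v S := by
          simp only [w, Finset.sum_apply]
          rw [Finset.sum_eq_single S]
          · simp
          · intro T hT hne
            have hT' : T.card + m = Fintype.card N := by simpa using hT
            rw [if_neg]
            intro hTS
            exact hne (Finset.eq_of_subset_of_card_le hTS (by omega))
          · intro hS'
            have hS'' : S.card + m ≠ Fintype.card N := by simpa using hS'
            rw [if_pos (Finset.Subset.refl S)]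
            exact hv S (by omega)
        simp [this]
      have := hadd (v - w) w i
      rw [sub_add_cancel] at this
      rw [this, hw, hvw, add_zero]
  apply key (Fintype.card N + 1) v
  intro S hS
  omega

lemma shap_sum_swap {N : Type*} [Fintype N] [DecidableEq N] (i : N) (f : Finset N → ℝ) :
    ∑ S ∈ (Finset.univ.erase i).powerset, f (insert i S)
      = ∑ T : Finset N, if i ∈ T then f T else 0 := by
  rw [← Finset.sum_filter]
  refine Finset.sum_bij' (fun S _ => insert i S) (fun T _ => T.erase i) ?_ ?_ ?_ ?_ ?_
  · intro S _; simp
  · intro S _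
    rw [Finset.mem_powerset]
    exact Finset.erase_subset_erase _ (Finset.subset_univ _)
  · intro S hS
    rw [Finset.mem_powerset] at hS
    exact Finset.erase_insert (fun h => by simpa using hS h)
  · intro S hS
    exact Finset.insert_erase (by simpa using hS)
  · intro S _; rfl

lemma shap_powerset {N : Type*} [Fintype N] [DecidableEq N] (i : N) :
    (Finset.univ.erase i).powerset = Finset.univ.filter (fun S : Finset N => i ∉ S) := by
  ext S
  simp [Finset.subset_erase]

/-- Efficiency of the Shapley value. -/
lemma shap_eff {n : ℕ} (hn : 1 ≤ n) (N : Type*) [Fintype N] [DecidableEq N]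
    (hcard : Fintype.card N = n) (v : Finset N → ℝ) :
    ∑ i : N, ∑ S ∈ (Finset.univ.erase i).powerset,
          ((S.card.factorial * (n - 1 - S.card).factorial : ℝ) / n.factorial) *
            (v (insert i S) - v S) = v Finset.univ - v ∅ := by
  have h1 : ∀ i : N, ∑ S ∈ (Finset.univ.erase i).powerset,
          ((S.card.factorial * (n - 1 - S.card).factorial : ℝ) / n.factorial) *
            (v (insert i S) - v S)
      = ∑ T : Finset N, ((if i ∈ T then
          (((T.card - 1).factorial * (n - T.card).factorial : ℝ) / n.factorial) * v T else 0)
        - (if i ∉ T then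
          ((T.card.factorial * (n - 1 - T.card).factorial : ℝ) / n.factorial) * v T else 0)) := by
    intro i
    rw [Finset.sum_sub_distrib, ← shap_sum_swap i (fun T =>
      (((T.card - 1).factorial * (n - T.card).factorial : ℝ) / n.factorial) * v T),
      ← Finset.sum_filter, ← shap_powerset, ← Finset.sum_sub_distrib]
    refine Finset.sum_congr rfl (fun S hS => ?_)
    rw [Finset.mem_powerset] at hS
    have hi : i ∉ S := fun h => by simpa using hS h
    rw [Finset.card_insert_of_notMem hi, Nat.add_sub_cancel,
      show n - (S.card + 1) = n - 1 - S.card by omega]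
    ring
  rw [Finset.sum_congr rfl (fun i _ => h1 i), Finset.sum_comm]
  have hf : (n.factorial : ℝ) ≠ 0 := by exact_mod_cast n.factorial_ne_zero
  have h2 : ∀ T : Finset N, ∑ i : N, ((if i ∈ T then
          (((T.card - 1).factorial * (n - T.card).factorial : ℝ) / n.factorial) * v T else 0)
        - (if i ∉ T then
          ((T.card.factorial * (n - 1 - T.card).factorial : ℝ) / n.factorial) * v T else 0))
      = (if T = Finset.univ then v T else 0) - (if T = ∅ then v T else 0) := by
    intro T
    have hc : (Finset.univ.filter (fun i => i ∉ T)).card = n - T.card := by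
      rw [← hcard, ← Finset.card_compl]
      congr 1
      ext x; simp
    rw [Finset.sum_sub_distrib, ← Finset.sum_filter, ← Finset.sum_filter, Finset.sum_const,
      Finset.sum_const, hc, Finset.filter_univ_mem, nsmul_eq_mul, nsmul_eq_mul]
    have hle : T.card ≤ n := hcard ▸ Finset.card_le_univ T
    have e1 : T = Finset.univ ↔ T.card = n := by
      rw [← hcard, Finset.card_eq_iff_eq_univ]
    have e2 : T = ∅ ↔ T.card = 0 := Finset.card_eq_zero.symm
    simp only [e1, e2]
    generalize T.card = t at *
    generalize v T = x
    obtain ⟨d, rfl⟩ := Nat.exists_eq_add_of_le hle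
    rcases t with _ | t
    · rcases d with _ | d
      · omega
      · simp [Nat.factorial_succ] at hf ⊢
        field_simp
    · rcases d with _ | d
      · simp [Nat.factorial_succ] at hf ⊢
        field_simp
      · rw [show t + 1 + (d + 1) - (t + 1) = d + 1 by omega,
          show t + 1 + (d + 1) - 1 - (t + 1) = d by omega]
        simp [Nat.factorial_succ] 
        ring
  rw [Finset.sum_congr rfl (fun T _ => h2 T), Finset.sum_sub_distrib]
  simp

/-- Shapley's uniqueness theorem: any value operator `φ` on set functions over a
dataset `N` of `n` elements satisfying efficiency, symmetry, the null-player axiom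
and additivity coincides with the Data Shapley value
`DS_i(v) = Σ_{S ⊆ N\{i}} |S|!(n-1-|S|)!/n! · (v(S∪{i}) - v(S))`. -/
theorem data_shapley_unique
    {n : ℕ} (hn : 1 ≤ n) (N : Type*) [Fintype N] [DecidableEq N]
    (hcard : Fintype.card N = n)
    (φ : (Finset N → ℝ) → N → ℝ)
    (heff : ∀ v : Finset N → ℝ, ∑ i : N, φ v i = v Finset.univ - v ∅)
    (hsym : ∀ (v : Finset N → ℝ) (i j : N),
      (∀ S : Finset N, i ∉ S → j ∉ S → v (insert i S) = v (insert j S)) →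
      φ v i = φ v j)
    (hnull : ∀ (v : Finset N → ℝ) (i : N),
      (∀ S : Finset N, i ∉ S → v (insert i S) = v S) → φ v i = 0)
    (hadd : ∀ (v w : Finset N → ℝ) (i : N),
      φ (fun S => v S + w S) i = φ v i + φ w i) :
    ∀ (v : Finset N → ℝ) (i : N),
      φ v i =
        ∑ S ∈ (Finset.univ.erase i).powerset,
          ((S.card.factorial * (n - 1 - S.card).factorial : ℝ) / n.factorial) *
            (v (insert i S) - v S) := by
  intro v i
  rw [← sub_eq_zero]
  refine shap_zero (fun v i => φ v i - ∑ S ∈ (Finset.univ.erase i).powerset,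
          ((S.card.factorial * (n - 1 - S.card).factorial : ℝ) / n.factorial) *
            (v (insert i S) - v S)) ?_ ?_ ?_ ?_ v i
  · intro v
    rw [Finset.sum_sub_distrib, heff, shap_eff hn N hcard, sub_self]
  · intro v i j h
    have hv : ∀ S : Finset N, v (S.map (Equiv.swap i j).toEmbedding) = v S := by
      intro S
      by_cases hi : i ∈ S <;> by_cases hj : j ∈ S
      · congr 1
        ext x
        simp only [Finset.mem_map_equiv, Equiv.symm_swap, Equiv.swap_apply_def]
        grind
      · have := h (S.erase i) (by simp) (by simp [hj])
        rw [Finset.insert_erase hi] at this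
        rw [this]
        congr 1
        ext x
        simp only [Finset.mem_map_equiv, Equiv.symm_swap, Equiv.swap_apply_def]
        grind
      · have := h (S.erase j) (by simp [hi]) (by simp)
        rw [Finset.insert_erase hj] at this
        rw [← this]
        congr 1
        ext x
        simp only [Finset.mem_map_equiv, Equiv.symm_swap, Equiv.swap_apply_def]
        grind
      · congr 1
        ext x
        simp only [Finset.mem_map_equiv, Equiv.symm_swap, Equiv.swap_apply_def]
        grind
    rw [hsym v i j h, sub_right_inj]
    refine Finset.sum_equiv (Equiv.swap i j).finsetCongr ?_ ?_
    · intro S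
      simp [shap_powerset, Finset.mem_map_equiv]
    · intro S _
      have := hv (insert i S)
      rw [Finset.map_insert] at this
      simp only [Equiv.coe_toEmbedding, Equiv.swap_apply_left] at this
      simp only [Equiv.finsetCongr_apply, Finset.card_map, hv, this]
  · intro v i h
    rw [hnull v i h, Finset.sum_eq_zero, sub_zero]
    intro S hS
    rw [shap_powerset] at hS
    rw [h S (by simpa using hS), sub_self, mul_zero]
  · intro v w i
    have := hadd v w i
    simp only [Pi.add_apply]
    rw [show v + w = fun S => v S + w S from rfl, this, sub_add_sub_comm,
      ← Finset.sum_add_distrib]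
    congr 1
    exact Finset.sum_congr rfl (fun S _ => by ring)
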